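/- arXiv:2008.07472 — 2 statements merged into one kernel-verified Lean document; each statement's English description precedes it below -/
import Mathlib

section
/- Let T : ℋⁿ → ℋⁿ be an ℝ-linear positive map that is self-adjoint with respect to the trace inner product (T = T*). Then λ(|T(X)|) ≺_w λ(T(I))*λ(|X|) for all X ∈ ℋⁿ, and λ(T(I)) is the least vector of T. -/
open Matrix
open scoped ComplexOrder

/-- Sum of the `k` largest entries of `p` (as a supremum of sums over `k`-subsets). -/
noncomputable def sumLargest {n : ℕ} (p : Fin n → ℝ) (k : ℕ) : ℝ :=
  sSup ((fun A : Finset (Fin n) => ∑ i ∈ A, p i) '' {A : Finset (Fin n) | A.card = k})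

/-- `p` is weakly majorized by `q`. -/
def WeakMaj {n : ℕ} (p q : Fin n → ℝ) : Prop :=
  ∀ k : ℕ, 1 ≤ k → k ≤ n → sumLargest p k ≤ sumLargest q k

/-- `p` is majorized by `q`. -/
def Maj {n : ℕ} (p q : Fin n → ℝ) : Prop :=
  WeakMaj p q ∧ ∑ i, p i = ∑ i, q i

/-- `p` has nonnegative entries arranged in decreasing order. -/
def DecrNonneg {n : ℕ} (p : Fin n → ℝ) : Prop :=
  Antitone p ∧ ∀ i, 0 ≤ p i

/-- The decreasing rearrangement of a vector. -/
noncomputable def decrRearrange {n : ℕ} (p : Fin n → ℝ) : Fin n → ℝ :=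
  fun i => p (Tuple.sort p (Fin.rev i))

/-- `x` is the supremum of `S` in the weak-majorization order (w-sup). -/
def IsWSup {n : ℕ} (S : Set (Fin n → ℝ)) (x : Fin n → ℝ) : Prop :=
  DecrNonneg x ∧ (∀ s ∈ S, WeakMaj s x) ∧
    ∀ p : Fin n → ℝ, (∀ i, 0 ≤ p i) → (∀ s ∈ S, WeakMaj s p) → WeakMaj x p

/-- `x` is the infimum of `Q` in the weak-majorization order (w-inf). -/
def IsWInf {n : ℕ} (Q : Set (Fin n → ℝ)) (x : Fin n → ℝ) : Prop :=
  DecrNonneg x ∧ (∀ q ∈ Q, WeakMaj x q) ∧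
    ∀ p : Fin n → ℝ, (∀ i, 0 ≤ p i) → (∀ q ∈ Q, WeakMaj p q) → WeakMaj p x

open Classical in
/-- The vector of eigenvalues of a Hermitian matrix, in decreasing order
(junk value `0` if the matrix is not Hermitian). -/
noncomputable def specVec {n : ℕ} (X : Matrix (Fin n) (Fin n) ℂ) : Fin n → ℝ :=
  if h : X.IsHermitian then decrRearrange h.eigenvalues else 0

open Classical in
/-- `λ(|X|)`: the absolute values of the eigenvalues of a Hermitian matrix `X`,
in decreasing order. -/
noncomputable def absSpecVec {n : ℕ} (X : Matrix (Fin n) (Fin n) ℂ) : Fin n → ℝ :=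
  if h : X.IsHermitian then decrRearrange (fun i => |h.eigenvalues i|) else 0

/-- The Jordan product `X ∘ Y = (XY + YX)/2`. -/
noncomputable def jmul {n : ℕ} (X Y : Matrix (Fin n) (Fin n) ℂ) : Matrix (Fin n) (Fin n) ℂ :=
  (2 : ℂ)⁻¹ • (X * Y + Y * X)

/-- A nonzero (orthogonal) projection in `ℋⁿ`. -/
def IsProjection {n : ℕ} (P : Matrix (Fin n) (Fin n) ℂ) : Prop :=
  P.IsHermitian ∧ P * P = P ∧ P ≠ 0

/-- An involution in `ℋⁿ`: a Hermitian matrix with `ε² = I`. -/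
def IsInvolution {n : ℕ} (ε : Matrix (Fin n) (Fin n) ℂ) : Prop :=
  ε.IsHermitian ∧ ε * ε = 1

/-- A positive map: maps positive semidefinite matrices to positive semidefinite matrices. -/
def PositiveMap {n : ℕ} (T : Matrix (Fin n) (Fin n) ℂ → Matrix (Fin n) (Fin n) ℂ) : Prop :=
  ∀ X : Matrix (Fin n) (Fin n) ℂ, X.PosSemidef → (T X).PosSemidef

/-- `S` is the adjoint of `T` with respect to the trace inner product on `ℋⁿ`. -/
def IsAdjointOf {n : ℕ} (S T : Matrix (Fin n) (Fin n) ℂ → Matrix (Fin n) (Fin n) ℂ) : Prop :=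
  ∀ X Y : Matrix (Fin n) (Fin n) ℂ, X.IsHermitian → Y.IsHermitian →
    Matrix.trace (T X * Y) = Matrix.trace (X * S Y)

/-- `q` is the least vector of `T`: `λ(|T(X)|) ≺_w q * λ(|X|)` for all Hermitian `X`,
and `q ≺_w q'` for any other `q' ∈ (ℝⁿ₊)↓` with the same property. -/
def IsLeastVector {n : ℕ} (T : Matrix (Fin n) (Fin n) ℂ → Matrix (Fin n) (Fin n) ℂ)
    (q : Fin n → ℝ) : Prop :=
  DecrNonneg q ∧
  (∀ X : Matrix (Fin n) (Fin n) ℂ, X.IsHermitian →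
    WeakMaj (absSpecVec (T X)) (q * absSpecVec X)) ∧
  ∀ q' : Fin n → ℝ, DecrNonneg q' →
    (∀ X : Matrix (Fin n) (Fin n) ℂ, X.IsHermitian →
      WeakMaj (absSpecVec (T X)) (q' * absSpecVec X)) → WeakMaj q q'

/-- A complete family of rank-one orthogonal projections diagonalizing `X` with eigenvalues `x`. -/
structure IsSpectralResolution {n : ℕ} (X : Matrix (Fin n) (Fin n) ℂ) (x : Fin n → ℝ)
    (P : Fin n → Matrix (Fin n) (Fin n) ℂ) : Prop where
  isHermitian : ∀ i, (P i).IsHermitian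
  mul_self : ∀ i, P i * P i = P i
  trace_eq_one : ∀ i, (P i).trace = 1
  sum_eq_one : ∑ i, P i = 1
  eq_sum : X = ∑ i, x i • P i
  trace_mul : ∀ i, (X * P i).trace = x i

namespace IsSpectralResolution

variable {n : ℕ} {X : Matrix (Fin n) (Fin n) ℂ} {x : Fin n → ℝ}
  {P : Fin n → Matrix (Fin n) (Fin n) ℂ}

lemma reindex (h : IsSpectralResolution X x P) (σ : Equiv.Perm (Fin n)) :
    IsSpectralResolution X (x ∘ σ) (P ∘ σ) where
  isHermitian _ := h.isHermitian _
  mul_self _ := h.mul_self _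
  trace_eq_one _ := h.trace_eq_one _
  sum_eq_one := (Equiv.sum_comp σ P).trans h.sum_eq_one
  eq_sum := h.eq_sum.trans (Equiv.sum_comp σ fun i => x i • P i).symm
  trace_mul _ := h.trace_mul _

lemma trace_mul_nonneg (h : IsSpectralResolution X x P) {A : Matrix (Fin n) (Fin n) ℂ}
    (hA : A.PosSemidef) (i : Fin n) : 0 ≤ (A * P i).trace.re := by
  have h1 := (hA.mul_mul_conjTranspose_same (P i)).trace_nonneg
  rw [(h.isHermitian i).eq, Matrix.trace_mul_comm, ← Matrix.mul_assoc, h.mul_self,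
    Matrix.trace_mul_comm] at h1
  exact (Complex.le_def.1 h1).1

lemma posSemidef (h : IsSpectralResolution X x P) (i : Fin n) : (P i).PosSemidef := by
  have := Matrix.posSemidef_self_mul_conjTranspose (P i)
  rwa [(h.isHermitian i).eq, h.mul_self] at this

lemma sum_trace_mul (h : IsSpectralResolution X x P) (A : Matrix (Fin n) (Fin n) ℂ) :
    ∑ i, (A * P i).trace.re = A.trace.re := by
  rw [← Complex.re_sum, ← Matrix.trace_sum, ← Matrix.mul_sum, h.sum_eq_one, Matrix.mul_one]

/-- Ky Fan's inequality, for two spectral resolutions. -/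
lemma sum_trace_mul_le (h : IsSpectralResolution X x P) (hx : Antitone x) (hx0 : ∀ i, 0 ≤ x i)
    {Y : Matrix (Fin n) (Fin n) ℂ} {y : Fin n → ℝ} {Q : Fin n → Matrix (Fin n) (Fin n) ℂ}
    (hQ : IsSpectralResolution Y y Q) (B : Finset (Fin n)) :
    ∑ a ∈ B, (X * Q a).trace.re ≤ ∑ i : Fin n, if (i : ℕ) < B.card then x i else 0 := by
  set p : Fin n → ℝ := fun m => ∑ a ∈ B, (P m * Q a).trace.re with hp
  have hp0 : ∀ m, 0 ≤ p m := fun m =>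
    Finset.sum_nonneg fun a _ => hQ.trace_mul_nonneg (h.posSemidef m) a
  have hp1 : ∀ m, p m ≤ 1 := fun m => by
    calc p m ≤ ∑ a, (P m * Q a).trace.re :=
          Finset.sum_le_sum_of_subset_of_nonneg (Finset.subset_univ _)
            fun a _ _ => hQ.trace_mul_nonneg (h.posSemidef m) a
      _ = 1 := by rw [hQ.sum_trace_mul, h.trace_eq_one, Complex.one_re]
  have hpsum : ∑ m, p m = B.card := by
    rw [hp, Finset.sum_comm]
    calc ∑ a ∈ B, ∑ m, (P m * Q a).trace.re = ∑ a ∈ B, (1 : ℝ) := by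
          refine Finset.sum_congr rfl fun a _ => ?_
          simp_rw [Matrix.trace_mul_comm _ (Q a)]
          rw [h.sum_trace_mul, hQ.trace_eq_one, Complex.one_re]
      _ = B.card := by simp
  have hXQ : ∑ a ∈ B, (X * Q a).trace.re = ∑ m, x m * p m := by
    simp_rw [hp, Finset.mul_sum]
    rw [Finset.sum_comm]
    refine Finset.sum_congr rfl fun a _ => ?_
    conv_lhs => rw [h.eq_sum]
    simp [Matrix.sum_mul, Matrix.trace_sum]
  have hBn : B.card ≤ n := by simpa using Finset.card_le_univ B
  have hind : ∑ i : Fin n, (if (i : ℕ) < B.card then (1 : ℝ) else 0) = B.card := by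
    rw [Finset.sum_boole, Fin.card_filter_val_lt, min_eq_right hBn]
  obtain ⟨τ, hτ1, hτ2⟩ : ∃ τ : ℝ, (∀ m : Fin n, (m : ℕ) < B.card → τ ≤ x m) ∧
      ∀ m : Fin n, ¬ (m : ℕ) < B.card → x m * p m ≤ τ * p m := by
    rcases Nat.eq_zero_or_pos B.card with h0 | h0
    · refine ⟨0, fun m hm => hx0 m, fun m _ => ?_⟩
      have : p m = 0 := by simp [hp, Finset.card_eq_zero.1 h0]
      simp [this]
    · refine ⟨x ⟨B.card - 1, by omega⟩, fun m hm => hx ?_, fun m hm =>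
        mul_le_mul_of_nonneg_right (hx ?_) (hp0 m)⟩ <;> rw [Fin.le_def] <;> simp <;> omega
  rw [hXQ]
  have key : ∑ m, (x m * p m - τ * p m) ≤
      ∑ i : Fin n, ((if (i : ℕ) < B.card then x i else 0) -
        τ * (if (i : ℕ) < B.card then (1 : ℝ) else 0)) := by
    refine Finset.sum_le_sum fun m _ => ?_
    split_ifs with hm
    · nlinarith [hτ1 m hm, hp1 m]
    · linarith [hτ2 m hm]
  rw [Finset.sum_sub_distrib, Finset.sum_sub_distrib, ← Finset.mul_sum, ← Finset.mul_sum, hpsum,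
    hind] at key
  linarith

end IsSpectralResolution

section Spectrum

variable {n : ℕ} {X : Matrix (Fin n) (Fin n) ℂ}

lemma Matrix.IsHermitian.exists_isSpectralResolution (h : X.IsHermitian) :
    ∃ P, IsSpectralResolution X h.eigenvalues P := by
  set U : Matrix (Fin n) (Fin n) ℂ := h.eigenvectorUnitary.1
  have hUU : Uᴴ * U = 1 := by
    simpa [Matrix.star_eq_conjTranspose] using Unitary.coe_star_mul_self h.eigenvectorUnitary
  have hUU' : U * Uᴴ = 1 := by
    simpa [Matrix.star_eq_conjTranspose] using Unitary.coe_mul_star_self h.eigenvectorUnitary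
  have hX : X = U * diagonal (fun i => (h.eigenvalues i : ℂ)) * Uᴴ := by
    conv_lhs => rw [h.spectral_theorem, Unitary.conjStarAlgAut_apply]
    rfl
  have hmul : ∀ A B : Matrix (Fin n) (Fin n) ℂ,
      U * A * Uᴴ * (U * B * Uᴴ) = U * (A * B) * Uᴴ := fun A B => by
    calc U * A * Uᴴ * (U * B * Uᴴ) = U * A * (Uᴴ * U) * B * Uᴴ := by simp only [Matrix.mul_assoc]
      _ = U * (A * B) * Uᴴ := by rw [hUU]; simp only [Matrix.mul_assoc, Matrix.one_mul]
  have htr : ∀ A : Matrix (Fin n) (Fin n) ℂ, (U * A * Uᴴ).trace = A.trace := fun A => by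
    rw [Matrix.trace_mul_comm, ← Matrix.mul_assoc, hUU, Matrix.one_mul]
  have hdiag : ∀ d : Fin n → ℂ, ∑ i, diagonal (Pi.single i (d i)) = diagonal d := fun d => by
    ext a b
    rw [Matrix.sum_apply]
    by_cases hab : a = b
    · subst hab
      simp [Pi.single_apply]
    · simp [hab]
  refine ⟨fun i => U * diagonal (Pi.single i 1) * Uᴴ, ⟨fun i => ?_, fun i => ?_, fun i => ?_, ?_,
    ?_, fun i => ?_⟩⟩
  · refine Matrix.isHermitian_mul_mul_conjTranspose U
      (Matrix.isHermitian_diagonal_of_self_adjoint _ ?_)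
    ext j
    by_cases hj : j = i
    · subst hj; simp
    · simp [hj]
  · rw [hmul, Matrix.diagonal_mul_diagonal]
    congr 3
    ext j
    by_cases hj : j = i
    · subst hj; simp
    · simp [hj]
  · rw [htr]; simp [Matrix.trace_diagonal]
  · rw [← Finset.sum_mul, ← Finset.mul_sum, hdiag (fun _ => 1), Matrix.diagonal_one,
      Matrix.mul_one, hUU']
  · conv_lhs => rw [hX, ← hdiag, Finset.mul_sum, Finset.sum_mul]
    refine Finset.sum_congr rfl fun i _ => ?_
    rw [← Matrix.smul_mul, ← Matrix.mul_smul, ← Matrix.diagonal_smul]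
    congr 3
    ext j
    by_cases hj : j = i
    · subst hj; simp
    · simp [hj]
  · conv_lhs => rw [hX]
    rw [hmul, htr, Matrix.diagonal_mul_diagonal]
    simp [Matrix.trace_diagonal, Pi.single_apply]

lemma decrRearrange_eq_comp (p : Fin n → ℝ) :
    decrRearrange p = p ∘ (Fin.revPerm.trans (Tuple.sort p)) := rfl

lemma antitone_decrRearrange (p : Fin n → ℝ) : Antitone (decrRearrange p) :=
  fun _ _ h => Tuple.monotone_sort p (Fin.rev_le_rev.2 h)

lemma Matrix.PosSemidef.decrNonneg_specVec (h : X.PosSemidef) : DecrNonneg (specVec X) := by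
  rw [specVec, dif_pos h.1]
  exact ⟨antitone_decrRearrange _, fun i => h.eigenvalues_nonneg _⟩

lemma Matrix.PosSemidef.absSpecVec_eq (h : X.PosSemidef) : absSpecVec X = specVec X := by
  rw [specVec, dif_pos h.1, absSpecVec, dif_pos h.1]
  congr 1
  ext i
  exact abs_of_nonneg (h.eigenvalues_nonneg i)

lemma Matrix.IsHermitian.decrNonneg_absSpecVec (h : X.IsHermitian) :
    DecrNonneg (absSpecVec X) := by
  rw [absSpecVec, dif_pos h]
  exact ⟨antitone_decrRearrange _, fun i => abs_nonneg _⟩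

lemma Matrix.IsHermitian.exists_isSpectralResolution_specVec (h : X.IsHermitian) :
    ∃ P, IsSpectralResolution X (specVec X) P := by
  obtain ⟨P, hP⟩ := h.exists_isSpectralResolution
  rw [specVec, dif_pos h, decrRearrange_eq_comp]
  exact ⟨_, hP.reindex _⟩

lemma Matrix.IsHermitian.exists_isSpectralResolution_absSpecVec (h : X.IsHermitian) :
    ∃ x P, IsSpectralResolution X x P ∧ ∀ i, absSpecVec X i = |x i| := by
  obtain ⟨P, hP⟩ := h.exists_isSpectralResolution
  rw [absSpecVec, dif_pos h, decrRearrange_eq_comp]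
  exact ⟨_, _, hP.reindex _, fun i => rfl⟩

lemma absSpecVec_one : absSpecVec (1 : Matrix (Fin n) (Fin n) ℂ) = 1 := by
  obtain ⟨x, P, hP, hx⟩ :=
    (Matrix.isHermitian_one (n := Fin n) (α := ℂ)).exists_isSpectralResolution_absSpecVec
  ext i
  have h1 := hP.trace_mul i
  rw [Matrix.one_mul, hP.trace_eq_one] at h1
  rw [hx, ← Complex.ofReal_injective (h1.symm.trans Complex.ofReal_one.symm).symm]
  simp

end Spectrum

section SumLargest

variable {n k : ℕ}

lemma sumLargest_le (p : Fin n → ℝ) (hk : k ≤ n) {c : ℝ}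
    (h : ∀ A : Finset (Fin n), A.card = k → ∑ i ∈ A, p i ≤ c) : sumLargest p k ≤ c := by
  refine csSup_le ?_ ?_
  · obtain ⟨A, -, hA⟩ := Finset.exists_subset_card_eq (s := (Finset.univ : Finset (Fin n)))
      (n := k) (by simpa using hk)
    exact ⟨_, A, hA, rfl⟩
  · rintro _ ⟨A, hA, rfl⟩
    exact h A hA

lemma le_sumLargest (p : Fin n → ℝ) {A : Finset (Fin n)} (hA : A.card = k) :
    ∑ i ∈ A, p i ≤ sumLargest p k :=
  le_csSup (Set.toFinite _).bddAbove ⟨A, hA, rfl⟩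

end SumLargest

/-- Summation by parts: an antitone weight preserves nonnegativity of partial sums. -/
lemma mul_sum_le_sum_mul_of_antitone : ∀ {n : ℕ} {y e : Fin n → ℝ} {m : ℝ}, Antitone y →
    (∀ i, m ≤ y i) → (∀ j : ℕ, 0 ≤ ∑ i : Fin n, if (i : ℕ) < j then e i else 0) →
    m * ∑ i, e i ≤ ∑ i, y i * e i
  | 0, y, e, m, _, _, _ => by simp
  | n + 1, y, e, m, hy, hm, he => by
    have ih := mul_sum_le_sum_mul_of_antitone (n := n) (y := fun i => y i.castSucc)
      (e := fun i => e i.castSucc) (m := y (Fin.last n))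
      (fun a b hab => hy (Fin.castSucc_le_castSucc_iff.2 hab)) (fun i => hy (Fin.le_last _))
      (fun j => by
        refine (he (min j n)).trans_eq ?_
        rw [Fin.sum_univ_castSucc]
        simp)
    have hsum : 0 ≤ ∑ i, e i := by
      refine (he (n + 1)).trans_eq (Finset.sum_congr rfl fun i _ => if_pos i.2)
    have := mul_le_mul_of_nonneg_right (hm (Fin.last n)) hsum
    rw [Fin.sum_univ_castSucc] at this ⊢
    rw [Fin.sum_univ_castSucc (fun i => y i * e i)]
    linarith

lemma sum_mul_le_of_antitone {n : ℕ} {y c d : Fin n → ℝ} (hy : Antitone y) (hy0 : ∀ i, 0 ≤ y i)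
    (hcd : ∀ j : ℕ, j ≤ n → ∑ i : Fin n, (if (i : ℕ) < j then c i else 0) ≤
      ∑ i : Fin n, if (i : ℕ) < j then d i else 0) :
    ∑ i, y i * c i ≤ ∑ i, y i * d i := by
  have h := mul_sum_le_sum_mul_of_antitone (e := fun i => d i - c i) hy hy0 fun j => by
    have h1 := hcd (min j n) (min_le_right _ _)
    simp only [lt_min_iff, Fin.is_lt, and_true] at h1
    rw [← sub_nonneg, ← Finset.sum_sub_distrib] at h1
    refine h1.trans_eq (Finset.sum_congr rfl fun i _ => ?_)
    split_ifs <;> simp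
  simp only [mul_sub, Finset.sum_sub_distrib] at h
  linarith

/-- The absolute spectrum of `T X` is weakly majorized by `λ(T 1) * λ(|X|)`, for `T` positive and
self-adjoint. -/
lemma weakMaj_of_positive_selfAdjoint {n : ℕ}
    {T : Matrix (Fin n) (Fin n) ℂ → Matrix (Fin n) (Fin n) ℂ}
    (hTlin : IsLinearMap ℝ T) (hTpos : PositiveMap T)
    (hT : ∀ X : Matrix (Fin n) (Fin n) ℂ, X.IsHermitian → (T X).IsHermitian)
    (hsa : IsAdjointOf T T) {X : Matrix (Fin n) (Fin n) ℂ} (hX : X.IsHermitian) :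
    WeakMaj (absSpecVec (T X)) (specVec (T 1) * absSpecVec X) := by
  intro k _ hkn
  have hT1 : (T 1).PosSemidef := hTpos 1 Matrix.PosSemidef.one
  obtain ⟨hμ, hμ0⟩ := hT1.decrNonneg_specVec
  obtain ⟨R, hR⟩ := hT1.1.exists_isSpectralResolution_specVec
  set μ := specVec (T 1)
  obtain ⟨hy, hy0⟩ := hX.decrNonneg_absSpecVec
  obtain ⟨x, P, hP, hxy⟩ := hX.exists_isSpectralResolution_absSpecVec
  set y := absSpecVec X
  obtain ⟨t, Q, hQ, ht⟩ := (hT X hX).exists_isSpectralResolution_absSpecVec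
  set L : Matrix (Fin n) (Fin n) ℂ →ₗ[ℝ] Matrix (Fin n) (Fin n) ℂ := hTlin.mk' T
  have hL : ∀ A, T A = L A := fun A => rfl
  set M : Fin n → Fin n → ℝ := fun a i => (T (P i) * Q a).trace.re
  have hM0 : ∀ a i, 0 ≤ M a i := fun a i => hQ.trace_mul_nonneg (hTpos _ (hP.posSemidef i)) a
  have hrow : ∀ a, ∑ i, M a i = (T 1 * Q a).trace.re := fun a => by
    rw [← hP.sum_eq_one, hL, map_sum, Matrix.sum_mul, Matrix.trace_sum, Complex.re_sum]
    rfl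
  have hcol : ∀ i, ∑ a, M a i = (T 1 * P i).trace.re := fun i => by
    rw [hQ.sum_trace_mul, hsa 1 (P i) Matrix.isHermitian_one (hP.isHermitian i), Matrix.one_mul]
  have htM : ∀ a, t a = ∑ i, x i * M a i := fun a => by
    have h1 := congrArg Complex.re (hQ.trace_mul a)
    rw [Complex.ofReal_re] at h1
    rw [← h1, hP.eq_sum, hL, map_sum, Matrix.sum_mul, Matrix.trace_sum, Complex.re_sum]
    refine Finset.sum_congr rfl fun i _ => ?_
    rw [map_smul, Matrix.smul_mul, Matrix.trace_smul, Complex.smul_re, smul_eq_mul]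
    rfl
  refine sumLargest_le _ hkn fun A hA => ?_
  calc ∑ a ∈ A, absSpecVec (T X) a ≤ ∑ a ∈ A, ∑ i, y i * M a i := by
        refine Finset.sum_le_sum fun a _ => ?_
        rw [ht, htM]
        refine (Finset.abs_sum_le_sum_abs _ _).trans_eq (Finset.sum_congr rfl fun i _ => ?_)
        rw [abs_mul, abs_of_nonneg (hM0 a i), hxy]
    _ = ∑ i, y i * ∑ a ∈ A, M a i := by
        rw [Finset.sum_comm]
        simp_rw [Finset.mul_sum]
    _ ≤ ∑ i, y i * (if (i : ℕ) < k then μ i else 0) := by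
        refine sum_mul_le_of_antitone hy hy0 fun j hj => ?_
        rcases le_total j k with hjk | hkj
        · have hcard : (Finset.univ.filter fun i : Fin n => (i : ℕ) < j).card = j := by
            rw [Fin.card_filter_val_lt, min_eq_right hj]
          rw [← Finset.sum_filter]
          calc ∑ i with Fin.val i < j, ∑ a ∈ A, M a i ≤
                ∑ i with Fin.val i < j, (T 1 * P i).trace.re := by
                refine Finset.sum_le_sum fun i _ => ?_
                rw [← hcol]
                exact Finset.sum_le_sum_of_subset_of_nonneg (Finset.subset_univ _)
                  fun a _ _ => hM0 a i
            _ ≤ _ := hR.sum_trace_mul_le hμ hμ0 hP _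
            _ = _ := by
                rw [hcard]
                refine Finset.sum_congr rfl fun i _ => ?_
                split_ifs <;> first | rfl | omega
        · calc ∑ i : Fin n, (if (i : ℕ) < j then ∑ a ∈ A, M a i else 0) ≤
                ∑ i, ∑ a ∈ A, M a i := by
                refine Finset.sum_le_sum fun i _ => ?_
                split_ifs
                · exact le_rfl
                · exact Finset.sum_nonneg fun a _ => hM0 a i
            _ = ∑ a ∈ A, (T 1 * Q a).trace.re := by
                rw [Finset.sum_comm]
                exact Finset.sum_congr rfl fun a _ => hrow a
            _ ≤ _ := hR.sum_trace_mul_le hμ hμ0 hQ _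
            _ = _ := by
                rw [hA]
                refine Finset.sum_congr rfl fun i _ => ?_
                split_ifs <;> first | rfl | omega
    _ = ∑ i with Fin.val i < k, (μ * y) i := by
        rw [Finset.sum_filter]
        refine Finset.sum_congr rfl fun i _ => ?_
        split_ifs <;> simp [mul_comm]
    _ ≤ sumLargest (μ * y) k :=
        le_sumLargest _ (by rw [Fin.card_filter_val_lt, min_eq_right hkn])

theorem least_vector_of_positive_selfAdjoint (n : ℕ) (T : Matrix (Fin n) (Fin n) ℂ → Matrix (Fin n) (Fin n) ℂ)
    (hTlin : IsLinearMap ℝ T) (hTpos : PositiveMap T)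
    (hT : ∀ X : Matrix (Fin n) (Fin n) ℂ, X.IsHermitian → (T X).IsHermitian)
    (hsa : IsAdjointOf T T) :
    (∀ X : Matrix (Fin n) (Fin n) ℂ, X.IsHermitian →
      WeakMaj (absSpecVec (T X)) (specVec (T 1) * absSpecVec X)) ∧
    IsLeastVector T (specVec (T 1)) := by
  have hT1 : (T 1).PosSemidef := hTpos 1 Matrix.PosSemidef.one
  have hmaj := fun X hX => weakMaj_of_positive_selfAdjoint hTlin hTpos hT hsa (X := X) hX
  refine ⟨hmaj, hT1.decrNonneg_specVec, hmaj, fun q' _ hq' => ?_⟩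
  have := hq' 1 Matrix.isHermitian_one
  rwa [hT1.absSpecVec_eq, absSpecVec_one, mul_one] at this
end

section
/- Let 1 ≤ p, r, s < ∞ with 1/p = 1/r + 1/s, let T : ℋⁿ → ℋⁿ be an ℝ-linear map, and let q ∈ (ℝⁿ₊)↓ satisfy λ(|T(X)|) ≺_w q*λ(|X|) for all X ∈ ℋⁿ. Then for all X ∈ ℋⁿ, ‖T(X)‖_p ≤ ‖q‖_r ‖X‖_s, where for Y ∈ ℋⁿ, ‖Y‖_p = (Σᵢ λᵢ(|Y|)^p)^{1/p} is the spectral p-norm and ‖q‖_r is the ℓ^r-norm of q in ℝⁿ. -/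
open Matrix
open scoped ComplexOrder

theorem sum_mul_nonneg_of_prefix_sums_nonneg {n : ℕ} {w d : Fin n → ℝ}
    (hw : DecrNonneg w)
    (hd : ∀ k : ℕ, 1 ≤ k → k ≤ n → 0 ≤ ∑ i : Fin n, if (i : ℕ) < k then d i else 0) :
    0 ≤ ∑ i, w i * d i := by
  induction n with
  | zero => simp
  | succ n ih =>
    have hprefix := ih (w := fun i => w i.castSucc - w (Fin.last n)) (d := fun i => d i.castSucc)
      ⟨fun i j hij => sub_le_sub_right (hw.1 (Fin.castSucc_le_castSucc_iff.mpr hij)) _,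
        fun i => sub_nonneg.mpr (hw.1 (Fin.le_last _))⟩
      (fun k hk hkn => by
        have h := hd k hk (hkn.trans n.le_succ)
        rw [Fin.sum_univ_castSucc] at h
        simpa [not_lt.mpr hkn] using h)
    have htotal : 0 ≤ ∑ i, d i := by
      simpa only [Fin.is_lt, if_true] using hd (n + 1) (by omega) le_rfl
    have hsplit : ∑ i, w i * d i =
        (∑ i : Fin n, (w i.castSucc - w (Fin.last n)) * d i.castSucc) +
          w (Fin.last n) * ∑ i, d i := by
      simp only [Fin.sum_univ_castSucc, sub_mul, Finset.sum_sub_distrib, ← Finset.mul_sum]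
      ring
    rw [hsplit]
    exact add_nonneg hprefix (mul_nonneg (hw.2 _) htotal)

theorem sumLargest_eq_prefix_sum {n : ℕ} {p : Fin n → ℝ} (hp : Antitone p) {k : ℕ}
    (hk : 1 ≤ k) (hkn : k ≤ n) :
    sumLargest p k = ∑ i : Fin n, if (i : ℕ) < k then p i else 0 := by
  have hcard : (Finset.univ.filter fun i : Fin n => (i : ℕ) < k).card = k := by
    simp [Fin.card_filter_val_lt, hkn]
  have hmem : (∑ i : Fin n, if (i : ℕ) < k then p i else 0) ∈
      (fun A : Finset (Fin n) => ∑ i ∈ A, p i) '' {A : Finset (Fin n) | A.card = k} :=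
    ⟨_, hcard, Finset.sum_filter _ _⟩
  refine IsGreatest.csSup_eq ⟨hmem, ?_⟩
  rintro _ ⟨A, hA, rfl⟩
  have hA : A.card = k := hA
  let t : ℝ := p ⟨k - 1, by omega⟩
  have hle : ∑ i ∈ A, (p i - t) ≤ ∑ i with (i : Fin n).val < k, (p i - t) := by
    rw [Finset.sum_filter, ← Finset.sum_ite_mem_eq A]
    refine Finset.sum_le_sum fun i _ => ?_
    have hlow (h : (i : ℕ) < k) : t ≤ p i := hp (Fin.le_def.mpr (by simp only; omega))
    have hhigh (h : ¬ (i : ℕ) < k) : p i ≤ t := hp (Fin.le_def.mpr (by simp only; omega))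
    split_ifs with h₁ h₂ h₂
    · exact le_rfl
    · exact sub_nonpos.mpr (hhigh h₂)
    · exact sub_nonneg.mpr (hlow h₂)
    · exact le_rfl
  simp only [Finset.sum_sub_distrib, Finset.sum_const, hA, hcard] at hle
  rw [← Finset.sum_filter]
  linarith

theorem sum_rpow_le_sum_rpow_of_weakMaj {n : ℕ} {a b : Fin n → ℝ} (ha : DecrNonneg a)
    (hb : DecrNonneg b) (hab : WeakMaj a b) {p : ℝ} (hp : 1 ≤ p) :
    ∑ i, a i ^ p ≤ ∑ i, b i ^ p := by
  have hp0 : 0 < p := by linarith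
  have habel := sum_mul_nonneg_of_prefix_sums_nonneg (w := fun i => a i ^ (p - 1))
    (d := fun i => b i - a i)
    ⟨fun i j hij => Real.rpow_le_rpow (ha.2 j) (ha.1 hij) (by linarith),
      fun i => Real.rpow_nonneg (ha.2 i) _⟩
    (fun k hk hkn => by
      have h := hab k hk hkn
      rw [sumLargest_eq_prefix_sum ha.1 hk hkn, sumLargest_eq_prefix_sum hb.1 hk hkn,
        ← sub_nonneg, ← Finset.sum_sub_distrib] at h
      refine h.trans_eq (Finset.sum_congr rfl fun i _ => ?_)
      split_ifs <;> simp)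
  have htangent (i : Fin n) : a i ^ (p - 1) * (b i - a i) ≤ (1 / p) * (b i ^ p - a i ^ p) := by
    have h := Real.geom_mean_le_arith_mean2_weighted (w₁ := 1 / p) (w₂ := 1 - 1 / p)
      (by positivity) (sub_nonneg.mpr ((div_le_one hp0).mpr hp))
      (Real.rpow_nonneg (hb.2 i) p) (Real.rpow_nonneg (ha.2 i) p) (by ring)
    rw [← Real.rpow_mul (hb.2 i), ← Real.rpow_mul (ha.2 i), mul_one_div_cancel hp0.ne',
      Real.rpow_one, show p * (1 - 1 / p) = p - 1 by field_simp] at h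
    have hpow : a i ^ (p - 1) * a i = a i ^ p := by
      rw [← Real.rpow_add_one' (ha.2 i) (by simpa using hp0.ne'), sub_add_cancel]
    rw [mul_sub, hpow]
    linarith
  have h := habel.trans (Finset.sum_le_sum fun i _ => htangent i)
  rw [← Finset.mul_sum, Finset.sum_sub_distrib] at h
  exact sub_nonneg.mp (nonneg_of_mul_nonneg_right h (by positivity))

theorem Lp_norm_mul_le {n : ℕ} {f g : Fin n → ℝ} (hf : ∀ i, 0 ≤ f i) (hg : ∀ i, 0 ≤ g i)
    {p r s : ℝ} (hp : 0 < p) (hr : 0 < r) (hs : 0 < s) (h : 1 / p = 1 / r + 1 / s) :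
    (∑ i, (f i * g i) ^ p) ^ (1 / p) ≤
      (∑ i, f i ^ r) ^ (1 / r) * (∑ i, g i ^ s) ^ (1 / s) := by
  have hconj : (r / p).HolderConjugate (s / p) := by
    rw [Real.holderConjugate_iff]
    have hsum : (r / p)⁻¹ + (s / p)⁻¹ = 1 := by
      have := congrArg (p * ·) h
      simp only [mul_add] at this
      rw [mul_one_div_cancel hp.ne'] at this
      rw [inv_div, inv_div, this]
      ring
    refine ⟨?_, hsum⟩
    have : (r / p)⁻¹ < 1 := by
      have : 0 < (s / p)⁻¹ := by positivity
      linarith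
    exact (inv_lt_one₀ (by positivity)).mp this
  have hholder := Real.inner_le_Lp_mul_Lq_of_nonneg Finset.univ hconj
    (f := fun i => f i ^ p) (g := fun i => g i ^ p)
    (fun i _ => Real.rpow_nonneg (hf i) _) (fun i _ => Real.rpow_nonneg (hg i) _)
  have hF : 0 ≤ ∑ i, f i ^ r := Finset.sum_nonneg fun i _ => Real.rpow_nonneg (hf i) _
  have hG : 0 ≤ ∑ i, g i ^ s := Finset.sum_nonneg fun i _ => Real.rpow_nonneg (hg i) _
  simp only [← Real.rpow_mul (hf _), ← Real.rpow_mul (hg _), mul_div_cancel₀ _ hp.ne',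
    ← Real.mul_rpow (hf _) (hg _)] at hholder
  refine (Real.rpow_le_rpow (Finset.sum_nonneg fun i _ =>
    Real.rpow_nonneg (mul_nonneg (hf i) (hg i)) _) hholder (by positivity)).trans_eq ?_
  rw [Real.mul_rpow (Real.rpow_nonneg hF _) (Real.rpow_nonneg hG _), ← Real.rpow_mul hF,
    ← Real.rpow_mul hG]
  congr 2 <;> field_simp

theorem decrNonneg_absSpecVec {n : ℕ} (X : Matrix (Fin n) (Fin n) ℂ) :
    DecrNonneg (absSpecVec X) := by
  unfold absSpecVec
  split_ifs with h
  · exact ⟨fun i j hij => Tuple.monotone_sort (fun i => |h.eigenvalues i|) (Fin.rev_anti hij),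
      fun i => abs_nonneg _⟩
  · exact ⟨fun _ _ _ => le_rfl, fun _ => le_rfl⟩

theorem DecrNonneg.mul {n : ℕ} {p q : Fin n → ℝ} (hp : DecrNonneg p) (hq : DecrNonneg q) :
    DecrNonneg (p * q) :=
  ⟨fun i j hij => mul_le_mul (hp.1 hij) (hq.1 hij) (hq.2 j) (hp.2 i),
    fun i => mul_nonneg (hp.2 i) (hq.2 i)⟩

theorem spectral_norm_estimate (n : ℕ) (pe re se : ℝ)
    (hpe : 1 ≤ pe) (hre : 1 ≤ re) (hse : 1 ≤ se)
    (hrs : 1 / pe = 1 / re + 1 / se)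
    (T : Matrix (Fin n) (Fin n) ℂ → Matrix (Fin n) (Fin n) ℂ) (hTlin : IsLinearMap ℝ T)
    (hT : ∀ X : Matrix (Fin n) (Fin n) ℂ, X.IsHermitian → (T X).IsHermitian)
    (q : Fin n → ℝ) (hq : DecrNonneg q)
    (hineq : ∀ X : Matrix (Fin n) (Fin n) ℂ, X.IsHermitian →
      WeakMaj (absSpecVec (T X)) (q * absSpecVec X)) :
    ∀ X : Matrix (Fin n) (Fin n) ℂ, X.IsHermitian →
      (∑ i, absSpecVec (T X) i ^ pe) ^ (1 / pe) ≤
        (∑ i, q i ^ re) ^ (1 / re) * (∑ i, absSpecVec X i ^ se) ^ (1 / se) := by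
  intro X hX
  have hTX := decrNonneg_absSpecVec (T X)
  have hXv := decrNonneg_absSpecVec X
  have hpe0 : 0 < pe := by linarith
  have hsum := sum_rpow_le_sum_rpow_of_weakMaj hTX (hq.mul hXv) (hineq X hX) hpe
  exact (Real.rpow_le_rpow (Finset.sum_nonneg fun i _ => Real.rpow_nonneg (hTX.2 i) _) hsum
    (by positivity)).trans
      (Lp_norm_mul_le hq.2 hXv.2 hpe0 (by linarith) (by linarith) hrs)
end
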